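/- Let k be a positive integer. If two virtual knots K and K' are related by a finite sequence of 2k-moves, then for every nonzero integer n the n-writhes satisfy J_n(K) ≡ J_n(K') (mod k). -/

import Mathlib

/-!
Combinatorial Gauss diagrams.

A Gauss diagram is encoded as a list of chord endpoints read along the
oriented circle from a basepoint.  Each endpoint records the (natural number)
label of its chord, whether it is the terminal endpoint of the (oriented)
chord, and the sign of the chord (`true` = +1, `false` = -1).
Diagrams are considered up to rotation of the basepoint and relabeling of the
chords; these renamings are included among the "Reidemeister" generators.
-/

structure Endpoint where
  label : ℕ
  isTerminal : Bool
  sign : Bool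
deriving DecidableEq

namespace Gauss

/-- The sign (±1) of the chord through an endpoint. -/
def signValue (e : Endpoint) : ℤ := if e.sign then 1 else -1

/-- The sign assigned to an endpoint: `ε` at the terminal endpoint and `-ε`
at the initial endpoint of a chord of sign `ε`. -/
def endpointValue (e : Endpoint) : ℤ := if e.isTerminal then signValue e else -signValue e

/-- The list of chord labels of the endpoints of a word. -/
def labels (L : List Endpoint) : List ℕ := L.map Endpoint.label

/-- A word is a Gauss diagram when every chord label occurring in it occurs
exactly twice, once as an initial and once as a terminal endpoint, with the
same sign at both occurrences. -/
def IsGaussDiagram (L : List Endpoint) : Prop :=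
  ∀ e ∈ L, (L.filter (fun x => x.label == e.label)).length = 2 ∧
    ∃ e' ∈ L, e'.label = e.label ∧ e'.isTerminal = !e.isTerminal ∧ e'.sign = e.sign

/-- Rotate a word so that the first endpoint satisfying `p` comes first. -/
def rotateTo (L : List Endpoint) (p : Endpoint → Bool) : List Endpoint :=
  match L.findIdx? p with
  | some i => L.drop i ++ L.take i
  | none => L

/-- The index of the chord labeled `c`: the sum of the signs assigned to the
endpoints on the arc running from the initial endpoint of the chord to its
terminal endpoint in the direction of the circle's orientation. -/
def chordIndex (L : List Endpoint) (c : ℕ) : ℤ :=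
  ((((rotateTo L (fun e => e.label == c && !e.isTerminal)).drop 1).takeWhile
      (fun e => e.label != c)).map endpointValue).sum

/-- `Jn L n`: the sum of the signs of the chords of `L` of index `n`. -/
def Jn (L : List Endpoint) (n : ℤ) : ℤ :=
  ((L.filter (fun e => e.isTerminal && decide (chordIndex L e.label = n))).map signValue).sum

/-- The odd writhe: the sum of the signs of the chords of odd index,
i.e. `J = Σ_{n odd} J_n`. -/
def oddWrithe (L : List Endpoint) : ℤ :=
  ((L.filter (fun e => e.isTerminal && decide (chordIndex L e.label % 2 ≠ 0))).map signValue).sum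

/-- Moving the basepoint of the circle. -/
def rotateStep (L L' : List Endpoint) : Prop :=
  ∃ x xs, L = x :: xs ∧ L' = xs ++ [x]

/-- Injective relabeling of the chords. -/
def relabelStep (L L' : List Endpoint) : Prop :=
  ∃ f : ℕ → ℕ, Function.Injective f ∧
    L' = L.map (fun e => Endpoint.mk (f e.label) e.isTerminal e.sign)

/-- Reidemeister move I (removal direction): remove an isolated chord whose
two endpoints are adjacent (either orientation, either sign). -/
def reid1 (L L' : List Endpoint) : Prop :=
  ∃ (A B : List Endpoint) (c : ℕ) (t s : Bool),
    c ∉ labels (A ++ B) ∧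
    L = A ++ [Endpoint.mk c t s, Endpoint.mk c (!t) s] ++ B ∧
    L' = A ++ B

/-- Reidemeister move II (removal direction): remove two chords of opposite
signs whose initial endpoints are adjacent and whose terminal endpoints are
adjacent (in either of the two admissible orders). -/
def reid2 (L L' : List Endpoint) : Prop :=
  ∃ (A B C : List Endpoint) (c d : ℕ) (s crossed : Bool),
    c ≠ d ∧ c ∉ labels (A ++ B ++ C) ∧ d ∉ labels (A ++ B ++ C) ∧
    L = A ++ [Endpoint.mk c false s, Endpoint.mk d false (!s)] ++ B ++
        (if crossed then [Endpoint.mk c true s, Endpoint.mk d true (!s)]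
         else [Endpoint.mk d true (!s), Endpoint.mk c true s]) ++ C ∧
    L' = A ++ B ++ C

/-- Reidemeister move III (a standard variant; together with the moves I, II,
rotations and relabelings it generates all versions of the third move). -/
def reid3 (L L' : List Endpoint) : Prop :=
  ∃ (A B C D : List Endpoint) (a b c : ℕ) (s : Bool),
    a ≠ b ∧ b ≠ c ∧ a ≠ c ∧
    L = A ++ [Endpoint.mk b false s, Endpoint.mk a false s] ++ B ++
        [Endpoint.mk a true s, Endpoint.mk c false (!s)] ++ C ++
        [Endpoint.mk b true s, Endpoint.mk c true (!s)] ++ D ∧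
    L' = A ++ [Endpoint.mk a false s, Endpoint.mk b false s] ++ B ++
        [Endpoint.mk c false (!s), Endpoint.mk a true s] ++ C ++
        [Endpoint.mk c true (!s), Endpoint.mk b true s] ++ D

/-- A single Reidemeister generator (including diagram renamings). -/
def reidStep (L L' : List Endpoint) : Prop :=
  rotateStep L L' ∨ relabelStep L L' ∨ reid1 L L' ∨ reid2 L L' ∨ reid3 L L'

/-- A Ξ-move: exchange the first and third of three consecutive endpoints
belonging to three distinct chords, keeping all signs and orientations. -/
def xiStep (L L' : List Endpoint) : Prop :=
  ∃ (A B : List Endpoint) (x y z : Endpoint),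
    x.label ≠ y.label ∧ y.label ≠ z.label ∧ x.label ≠ z.label ∧
    L = A ++ [x, y, z] ++ B ∧
    L' = A ++ [z, y, x] ++ B

/-- A 2k-move (removal direction): remove `2k` chords `c 0, …, c (2k-1)`, all
of sign `s`, whose `p`-endpoints appear consecutively on one arc and whose
`q`-endpoints appear consecutively on a disjoint arc, the chord `c i` being
oriented from `p` to `q` for even `i` (the paper's odd `i`, 1-indexed) and
from `q` to `p` for odd `i`, so initial and terminal endpoints alternate. -/
def move2k (k : ℕ) (L L' : List Endpoint) : Prop :=
  ∃ (A B C : List Endpoint) (c : ℕ → ℕ) (s : Bool),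
    (∀ i < 2 * k, ∀ j < 2 * k, c i = c j → i = j) ∧
    (∀ i < 2 * k, c i ∉ labels (A ++ B ++ C)) ∧
    L = A ++ (List.range (2 * k)).map (fun i => Endpoint.mk (c i) (decide (i % 2 = 1)) s)
          ++ B ++
        (List.range (2 * k)).map (fun i => Endpoint.mk (c i) (decide (i % 2 = 0)) s)
          ++ C ∧
    L' = A ++ B ++ C

/-- A crossing change: reverse the sign and the orientation of one chord. -/
def crossingChange (L L' : List Endpoint) : Prop :=
  ∃ c : ℕ,
    L' = L.map (fun e =>
      if e.label = c then Endpoint.mk e.label (!e.isTerminal) (!e.sign) else e)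

/-- Finite sequences of moves from `r`, performed in either direction. -/
def Moves (r : List Endpoint → List Endpoint → Prop) :
    List Endpoint → List Endpoint → Prop :=
  Relation.ReflTransGen (fun L L' => r L L' ∨ r L' L)

/-- Related by Reidemeister moves: the two words represent the same virtual knot. -/
def ReidEquiv : List Endpoint → List Endpoint → Prop := Moves reidStep

/-- Related by a finite sequence of 2k-moves (and Reidemeister moves). -/
def Rel2k (k : ℕ) : List Endpoint → List Endpoint → Prop :=
  Moves (fun L L' => reidStep L L' ∨ move2k k L L')

/-- Related by a finite sequence of Ξ-moves (and Reidemeister moves). -/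
def RelXi : List Endpoint → List Endpoint → Prop :=
  Moves (fun L L' => reidStep L L' ∨ xiStep L L')

/-- Related by a finite sequence of 2k-moves and Ξ-moves (and Reidemeister moves). -/
def Rel2kXi (k : ℕ) : List Endpoint → List Endpoint → Prop :=
  Moves (fun L L' => reidStep L L' ∨ move2k k L L' ∨ xiStep L L')

/-- Related by a finite sequence of crossing changes and Ξ-moves
(and Reidemeister moves). -/
def RelCCXi : List Endpoint → List Endpoint → Prop :=
  Moves (fun L L' => reidStep L L' ∨ crossingChange L L' ∨ xiStep L L')

/-- A shell-pair of sign `s`: two chords `c`, `d` of sign `s` whose four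
endpoints are consecutive, interleaved as 1st-3rd and 2nd-4th
(with arbitrary orientations `t`, `u` of the two shells). -/
def shellPair (c d : ℕ) (t u s : Bool) : List Endpoint :=
  [Endpoint.mk c t s, Endpoint.mk d u s, Endpoint.mk c (!t) s, Endpoint.mk d (!u) s]

/-- The Gauss diagram `G(a)`: `|a|` consecutive shell-pairs of sign `+1` if
`a > 0` and of sign `-1` if `a < 0`; `G(0)` has no chords.  It represents the
virtual knot `K(a)`. -/
def Gword (a : ℤ) : List Endpoint :=
  ((List.range a.natAbs).map
    (fun j => shellPair (2 * j) (2 * j + 1) false false (decide (0 < a)))).flatten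

/-- `Rel2kCount k m G G'`: `G` and `G'` are related by a finite sequence of
Reidemeister moves and exactly `m` 2k-moves. -/
inductive Rel2kCount (k : ℕ) : ℕ → List Endpoint → List Endpoint → Prop
  | refl (L : List Endpoint) : Rel2kCount k 0 L L
  | reid {m : ℕ} {L L' L'' : List Endpoint} :
      reidStep L L' ∨ reidStep L' L →
      Rel2kCount k m L' L'' → Rel2kCount k m L L''
  | move {m : ℕ} {L L' L'' : List Endpoint} :
      move2k k L L' ∨ move2k k L' L →
      Rel2kCount k m L' L'' → Rel2kCount k (m + 1) L L''

/-- The 2k-move distance: the minimal number of 2k-moves needed to relate the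
two diagrams (together with Reidemeister moves). -/
noncomputable def dist2k (k : ℕ) (L L' : List Endpoint) : ℕ :=
  sInf {m | Rel2kCount k m L L'}

end Gauss

namespace Gauss

/-- Sum of the endpoint values of a word. -/
def wsum (L : List Endpoint) : ℤ := (L.map endpointValue).sum

/-- Signed count of the endpoints labeled `c`. -/
def ncount (c : ℕ) : List Endpoint → ℤ
  | [] => 0
  | e :: L => (if e.label = c then (if e.isTerminal then 1 else -1) else 0) + ncount c L

/-- Linearized index, starting with partial sum `acc`. -/
def wt (c : ℕ) : ℤ → List Endpoint → ℤ
  | _, [] => 0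
  | acc, e :: L =>
    (if e.label = c then (if e.isTerminal then acc else -(acc + endpointValue e)) else 0)
      + wt c (acc + endpointValue e) L

/-- The writhe sum with respect to an arbitrary index function. -/
def jsum (f : ℕ → ℤ) (n : ℤ) : List Endpoint → ℤ
  | [] => 0
  | e :: L => (if e.isTerminal = true ∧ f e.label = n then signValue e else 0) + jsum f n L

/-- The writhe with the linearized index. -/
def jlin (L : List Endpoint) (n : ℤ) : ℤ := jsum (fun c => wt c 0 L) n L

/-- The balance condition. -/
def Bal (L : List Endpoint) : Prop := wsum L = 0 ∧ ∀ c, ncount c L = 0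

@[simp] lemma wsum_nil : wsum [] = 0 := rfl
@[simp] lemma wsum_cons (e : Endpoint) (L) : wsum (e :: L) = endpointValue e + wsum L := by
  simp [wsum]
@[simp] lemma wsum_append (L M : List Endpoint) : wsum (L ++ M) = wsum L + wsum M := by
  simp [wsum]

@[simp] lemma ncount_append (c : ℕ) (L M : List Endpoint) :
    ncount c (L ++ M) = ncount c L + ncount c M := by
  induction L with
  | nil => simp [ncount]
  | cons e L ih => simp only [List.cons_append, ncount, ih]; ring

@[simp] lemma jsum_append (f : ℕ → ℤ) (n : ℤ) (L M : List Endpoint) :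
    jsum f n (L ++ M) = jsum f n L + jsum f n M := by
  induction L with
  | nil => simp [jsum]
  | cons e L ih => simp only [List.cons_append, jsum, ih]; ring

lemma wt_append (c : ℕ) (acc : ℤ) (L M : List Endpoint) :
    wt c acc (L ++ M) = wt c acc L + wt c (acc + wsum L) M := by
  induction L generalizing acc with
  | nil => simp [wt]
  | cons e L ih => simp only [List.cons_append, wt, ih, wsum_cons]; ring_nf

lemma wt_shift (c : ℕ) (acc d : ℤ) (L : List Endpoint) :
    wt c (acc + d) L = wt c acc L + d * ncount c L := by
  induction L generalizing acc with
  | nil => simp [wt, ncount]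
  | cons e L ih =>
    simp only [wt, ncount]
    rw [show acc + d + endpointValue e = (acc + endpointValue e) + d by ring, ih]
    split_ifs <;> ring

lemma wt_fresh (c : ℕ) (acc : ℤ) (L : List Endpoint) (h : c ∉ labels L) : wt c acc L = 0 := by
  induction L generalizing acc with
  | nil => rfl
  | cons e L ih =>
    simp only [labels, List.map_cons, List.mem_cons, not_or] at h
    simp only [wt]
    rw [if_neg (fun h' => h.1 h'.symm), ih _ h.2]; rfl

lemma jsum_congr (f g : ℕ → ℤ) (n : ℤ) (L : List Endpoint)
    (h : ∀ c ∈ labels L, f c = g c) : jsum f n L = jsum g n L := by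
  induction L with
  | nil => rfl
  | cons e L ih =>
    simp only [labels, List.map_cons, List.mem_cons, forall_eq_or_imp] at h
    simp only [jsum]
    rw [h.1, ih h.2]

lemma wt_rotate (c : ℕ) (A B : List Endpoint) (h : Bal (A ++ B)) :
    wt c 0 (B ++ A) = wt c 0 (A ++ B) := by
  obtain ⟨h1, h2⟩ := h
  have h2 := h2 c
  simp only [wsum_append, ncount_append] at h1 h2
  rw [wt_append, wt_append, wt_shift, wt_shift]
  have e1 : wsum A = - wsum B := by linarith
  have e2 : ncount c A = - ncount c B := by linarith
  rw [e1, e2]; ring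

lemma jlin_rotate (A B : List Endpoint) (h : Bal (A ++ B)) (n : ℤ) :
    jlin (B ++ A) n = jlin (A ++ B) n := by
  unfold jlin
  simp only [wt_rotate _ A B h, jsum_append]
  ring

lemma bal_comm (A B : List Endpoint) : Bal (A ++ B) ↔ Bal (B ++ A) := by
  simp [Bal, add_comm]

lemma rotate_inv (L L' : List Endpoint) (h : rotateStep L L') :
    (Bal L ↔ Bal L') ∧ (Bal L → ∀ n, jlin L n = jlin L' n) := by
  obtain ⟨x, xs, rfl, rfl⟩ := h
  refine ⟨bal_comm [x] xs, fun hb n => (jlin_rotate [x] xs hb n).symm⟩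

/-- Relabeling of a word. -/
def renam (f : ℕ → ℕ) (L : List Endpoint) : List Endpoint :=
  L.map (fun e => Endpoint.mk (f e.label) e.isTerminal e.sign)

lemma ev_renam (f : ℕ → ℕ) (e : Endpoint) :
    endpointValue ⟨f e.label, e.isTerminal, e.sign⟩ = endpointValue e := rfl

lemma wsum_renam (f : ℕ → ℕ) (L : List Endpoint) : wsum (renam f L) = wsum L := by
  induction L with
  | nil => rfl
  | cons e L ih => simp only [renam, List.map_cons, wsum_cons] at *; rw [ih]; rfl

lemma ncount_renam (f : ℕ → ℕ) (hf : Function.Injective f) (c : ℕ) (L : List Endpoint) :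
    ncount (f c) (renam f L) = ncount c L := by
  induction L with
  | nil => rfl
  | cons e L ih => simp only [renam, List.map_cons, ncount, hf.eq_iff] at *; rw [ih]

lemma ncount_relab_out (f : ℕ → ℕ) (c : ℕ) (hc : ∀ d, f d ≠ c) (L : List Endpoint) :
    ncount c (renam f L) = 0 := by
  induction L with
  | nil => rfl
  | cons e L ih => simp only [renam, List.map_cons, ncount] at *; rw [ih]; simp [hc]

lemma wt_renam (f : ℕ → ℕ) (hf : Function.Injective f) (c : ℕ) (acc : ℤ) (L : List Endpoint) :
    wt (f c) acc (renam f L) = wt c acc L := by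
  induction L generalizing acc with
  | nil => rfl
  | cons e L ih =>
    simp only [renam, List.map_cons, wt, hf.eq_iff, ev_renam] at *; rw [ih]

lemma jsum_renam (f : ℕ → ℕ) (g : ℕ → ℤ) (n : ℤ) (L : List Endpoint) :
    jsum g n (renam f L) = jsum (fun c => g (f c)) n L := by
  induction L with
  | nil => rfl
  | cons e L ih =>
    simp only [renam, List.map_cons, jsum] at *; rw [ih]; rfl

lemma relabel_inv (L L' : List Endpoint) (h : relabelStep L L') :
    (Bal L ↔ Bal L') ∧ (∀ n, jlin L n = jlin L' n) := by
  obtain ⟨f, hf, rfl⟩ := h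
  change (Bal L ↔ Bal (renam f L)) ∧ (∀ n, jlin L n = jlin (renam f L) n)
  refine ⟨?_, fun n => ?_⟩
  · unfold Bal
    rw [wsum_renam]
    refine and_congr_right fun _ => ⟨fun h c => ?_, fun h c => ?_⟩
    · by_cases hc : ∃ d, f d = c
      · obtain ⟨d, rfl⟩ := hc
        rw [ncount_renam f hf, h]
      · exact ncount_relab_out f c (by simpa using hc) L
    · rw [← ncount_renam f hf, h]
  · unfold jlin
    rw [jsum_renam]
    simp only [wt_renam f hf]

lemma not_mem_labels_append {c : ℕ} {A B : List Endpoint} :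
    c ∉ labels (A ++ B) ↔ c ∉ labels A ∧ c ∉ labels B := by
  simp [labels]

lemma ne_of_fresh {c x : ℕ} {A : List Endpoint} (h : c ∉ labels A) (hx : x ∈ labels A) :
    c ≠ x := fun e => h (e ▸ hx)

lemma reid1_inv (L L' : List Endpoint) (h : reid1 L L') :
    (Bal L ↔ Bal L') ∧ (∀ n, n ≠ 0 → jlin L n = jlin L' n) := by
  obtain ⟨A, B, c, t, s, hc, rfl, rfl⟩ := h
  refine ⟨?_, fun n hn => ?_⟩
  · unfold Bal
    cases t <;> cases s <;>
      simp [ncount, endpointValue, signValue] <;> grind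
  · have hc' := not_mem_labels_append.1 hc
    have hold : ∀ x ∈ labels (A ++ B),
        wt x 0 (A ++ [Endpoint.mk c t s, Endpoint.mk c (!t) s] ++ B) = wt x 0 (A ++ B) := by
      intro x hx
      have := ne_of_fresh hc hx
      cases t <;> cases s <;> simp [wt_append, wt, endpointValue, signValue, this]
    have hnew : wt c 0 (A ++ [Endpoint.mk c t s, Endpoint.mk c (!t) s] ++ B) = 0 := by
      simp only [wt_append, wt_fresh c _ _ hc'.1, wt_fresh c _ _ hc'.2]
      cases t <;> cases s <;> simp [wt, endpointValue, signValue]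
    unfold jlin
    rw [← jsum_congr _ _ n _ hold]
    simp only [jsum_append, jsum, hnew]
    simp [hn.symm]

lemma reid2_inv (L L' : List Endpoint) (h : reid2 L L') :
    (Bal L ↔ Bal L') ∧ (∀ n, jlin L n = jlin L' n) := by
  obtain ⟨A, B, C, c, d, s, cr, hcd, hc, hd, hL, rfl⟩ := h
  refine ⟨?_, fun n => ?_⟩
  · subst hL
    have key : ∀ x, ncount x [Endpoint.mk c false s, Endpoint.mk d false (!s)] +
        ncount x (if cr then [Endpoint.mk c true s, Endpoint.mk d true (!s)]
         else [Endpoint.mk d true (!s), Endpoint.mk c true s]) = 0 := by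
      intro x
      cases cr <;> simp [ncount] <;> split_ifs <;> simp
    have key2 : wsum [Endpoint.mk c false s, Endpoint.mk d false (!s)] +
        wsum (if cr then [Endpoint.mk c true s, Endpoint.mk d true (!s)]
         else [Endpoint.mk d true (!s), Endpoint.mk c true s]) = 0 := by
      cases cr <;> cases s <;> simp [endpointValue, signValue]
    simp only [Bal, wsum_append, ncount_append]
    refine and_congr ?_ (forall_congr' fun x => ?_)
    · constructor <;> intro <;> linarith
    · have := key x
      constructor <;> intro <;> linarith
  · have hc' := not_mem_labels_append.1 hc
    have hd' := not_mem_labels_append.1 hd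
    have hc'' := not_mem_labels_append.1 hc'.1
    have hd'' := not_mem_labels_append.1 hd'.1
    have hold : ∀ x ∈ labels (A ++ B ++ C), wt x 0 L = wt x 0 (A ++ B ++ C) := by
      intro x hx
      have h1 := ne_of_fresh hc hx
      have h2 := ne_of_fresh hd hx
      subst hL
      cases cr <;> cases s <;> simp [wt_append, wt, endpointValue, signValue, h1, h2]
    have hnew : wt c 0 L = wt d 0 L := by
      subst hL
      simp only [wt_append, wt_fresh c _ _ hc''.1, wt_fresh c _ _ hc''.2, wt_fresh c _ _ hc'.2,
        wt_fresh d _ _ hd''.1, wt_fresh d _ _ hd''.2, wt_fresh d _ _ hd'.2]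
      cases cr <;> cases s <;> simp [wt, endpointValue, signValue, hcd, hcd.symm] <;> ring
    unfold jlin
    rw [← jsum_congr _ _ n _ hold]
    generalize hf : (fun c => wt c 0 L) = f
    have hfcd : f c = f d := by rw [← hf]; exact hnew
    subst hL
    cases cr <;> cases s <;> simp [jsum, hfcd, signValue] <;> split_ifs <;> simp

lemma reid3_inv (L L' : List Endpoint) (h : reid3 L L') :
    (Bal L ↔ Bal L') ∧ (∀ n, jlin L n = jlin L' n) := by
  obtain ⟨A, B, C, D, a, b, c, s, hab, hbc, hac, hL, hL'⟩ := h
  have hS : wsum L = wsum L' := by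
    subst hL hL'
    simp only [wsum_append, wsum_cons, wsum_nil]; ring
  have hN : ∀ x, ncount x L = ncount x L' := by
    intro x
    subst hL hL'
    simp only [ncount_append, ncount]; ring
  have hW : ∀ x, wt x 0 L = wt x 0 L' := by
    intro x
    subst hL hL'
    simp only [wt_append, wt, wsum_append, wsum_cons, wsum_nil]
    have e1 : ∀ p q : ℤ, p + (q + 0) = p + q := by intros; ring
    cases s <;> simp [endpointValue, signValue] <;> ring_nf <;> split_ifs <;>
      first | omega | (ring_nf)
  refine ⟨by simp only [Bal, hS, hN], fun n => ?_⟩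
  unfold jlin
  simp only [hW]
  generalize (fun c => wt c 0 L') = f
  subst hL hL'
  simp only [jsum_append, jsum]; ring

/-- The first arc of a 2k-move. -/
def parc (c : ℕ → ℕ) (s : Bool) (k : ℕ) : List Endpoint :=
  (List.range (2 * k)).map (fun i => Endpoint.mk (c i) (decide (i % 2 = 1)) s)

/-- The second arc of a 2k-move. -/
def qarc (c : ℕ → ℕ) (s : Bool) (k : ℕ) : List Endpoint :=
  (List.range (2 * k)).map (fun i => Endpoint.mk (c i) (decide (i % 2 = 0)) s)

lemma parc_succ (c : ℕ → ℕ) (s : Bool) (k : ℕ) : parc c s (k + 1) =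
    parc c s k ++ [⟨c (2 * k), false, s⟩, ⟨c (2 * k + 1), true, s⟩] := by
  simp [parc, mul_add, List.range_succ, Nat.add_mod]

lemma qarc_succ (c : ℕ → ℕ) (s : Bool) (k : ℕ) : qarc c s (k + 1) =
    qarc c s k ++ [⟨c (2 * k), true, s⟩, ⟨c (2 * k + 1), false, s⟩] := by
  simp [qarc, mul_add, List.range_succ, Nat.add_mod]

/-- Sign as an integer. -/
def sg (s : Bool) : ℤ := if s then 1 else -1

lemma wsum_parc (c : ℕ → ℕ) (s : Bool) (k : ℕ) : wsum (parc c s k) = 0 := by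
  induction k with
  | zero => rfl
  | succ k ih => rw [parc_succ, wsum_append, ih]; simp [endpointValue, signValue]

lemma wsum_qarc (c : ℕ → ℕ) (s : Bool) (k : ℕ) : wsum (qarc c s k) = 0 := by
  induction k with
  | zero => rfl
  | succ k ih => rw [qarc_succ, wsum_append, ih]; simp [endpointValue, signValue]

lemma ncount_pq (c : ℕ → ℕ) (s : Bool) (k x : ℕ) :
    ncount x (parc c s k) + ncount x (qarc c s k) = 0 := by
  induction k with
  | zero => rfl
  | succ k ih =>
    rw [parc_succ, qarc_succ, ncount_append, ncount_append]
    simp only [ncount]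
    have : ncount x (qarc c s k) = - ncount x (parc c s k) := by linarith
    rw [this]
    simp only [if_true, Bool.false_eq_true, if_false]
    split_ifs <;> ring

lemma two_mul_succ_range (k : ℕ) (f : ℕ → ℤ) : ∑ i ∈ Finset.range (2 * (k + 1)), f i =
    ∑ i ∈ Finset.range (2 * k), f i + f (2 * k) + f (2 * k + 1) := by
  rw [mul_add, mul_one, Finset.sum_range_succ, Finset.sum_range_succ]

lemma wt_pq (c : ℕ → ℕ) (s : Bool) (k x : ℕ) (a b : ℤ) :
    wt x a (parc c s k) + wt x b (qarc c s k) =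
      ∑ i ∈ Finset.range (2 * k),
        (if c i = x then (if i % 2 = 0 then b - a + sg s else a - b - sg s) else 0) := by
  induction k with
  | zero => rfl
  | succ k ih =>
    rw [two_mul_succ_range, ← ih, parc_succ, qarc_succ, wt_append, wt_append, wsum_parc, wsum_qarc]
    have h1 : (2 * k) % 2 = 0 := by omega
    have h2 : (2 * k + 1) % 2 = 1 := by omega
    simp only [wt, h1, h2, endpointValue, signValue, sg]
    cases s <;> simp <;> split_ifs <;> ring

lemma jsum_pq (c : ℕ → ℕ) (s : Bool) (k : ℕ) (f : ℕ → ℤ) (n u v : ℤ)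
    (hf : ∀ i < 2 * k, f (c i) = if i % 2 = 0 then u else v) :
    jsum f n (parc c s k) + jsum f n (qarc c s k) =
      k * ((if u = n then sg s else 0) + (if v = n then sg s else 0)) := by
  induction k with
  | zero => simp [parc, qarc, jsum]
  | succ k ih =>
    have ih := ih (fun i hi => hf i (by omega))
    have h1 : f (c (2 * k)) = u := by rw [hf _ (by omega), if_pos (by omega)]
    have h2 : f (c (2 * k + 1)) = v := by rw [hf _ (by omega), if_neg (by omega)]
    rw [parc_succ, qarc_succ, jsum_append, jsum_append]
    simp only [jsum, h1, h2, signValue]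
    push_cast
    rw [add_mul, ← ih]
    simp [sg]
    ring

lemma move2k_inv (k : ℕ) (L L' : List Endpoint) (h : move2k k L L') :
    (Bal L ↔ Bal L') ∧ (∀ n, jlin L n ≡ jlin L' n [ZMOD (k : ℤ)]) := by
  obtain ⟨A, B, C, c, s, hinj, hc, hL, rfl⟩ := h
  change L = A ++ parc c s k ++ B ++ qarc c s k ++ C at hL
  refine ⟨?_, fun n => ?_⟩
  · subst hL
    simp only [Bal, wsum_append, ncount_append, wsum_parc, wsum_qarc]
    refine and_congr (by simp) (forall_congr' fun x => ?_)
    have := ncount_pq c s k x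
    constructor <;> intro <;> linarith
  · have hW : ∀ x, wt x 0 L = wt x 0 (A ++ B ++ C) +
        ∑ i ∈ Finset.range (2 * k),
          (if c i = x then (if i % 2 = 0 then wsum B + sg s else - wsum B - sg s) else 0) := by
      intro x
      have := wt_pq c s k x (wsum A) (wsum A + wsum B)
      simp only [add_sub_cancel_left, sub_add_cancel_left] at this
      subst hL
      rw [← this]
      simp only [wt_append, wsum_append, wsum_parc, wsum_qarc, add_zero, zero_add]
      ring
    have hold : ∀ x ∈ labels (A ++ B ++ C), wt x 0 L = wt x 0 (A ++ B ++ C) := by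
      intro x hx
      rw [hW, Finset.sum_eq_zero, add_zero]
      intro i hi
      rw [if_neg (ne_of_fresh (hc i (Finset.mem_range.1 hi)) hx)]
    have hnew : ∀ i < 2 * k, wt (c i) 0 L =
        if i % 2 = 0 then wsum B + sg s else - wsum B - sg s := by
      intro i hi
      rw [hW, wt_fresh _ _ _ (hc i hi), zero_add, Finset.sum_eq_single i]
      · simp
      · intro j hj hji
        rw [if_neg (fun h => hji (hinj j (Finset.mem_range.1 hj) i hi h))]
      · intro h; exact absurd (Finset.mem_range.2 hi) h
    unfold jlin
    rw [← jsum_congr _ _ n _ hold]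
    have := jsum_pq c s k (fun c => wt c 0 L) n _ _ hnew
    generalize (fun c => wt c 0 L) = f at this
    subst hL
    simp only [jsum_append]
    refine Int.ModEq.symm ((Int.modEq_iff_dvd).2 ?_)
    refine ⟨_, Eq.trans ?_ this⟩
    ring

lemma step_inv (k : ℕ) (L L' : List Endpoint) (h : reidStep L L' ∨ move2k k L L') :
    (Bal L ↔ Bal L') ∧ (Bal L → ∀ n, n ≠ 0 → jlin L n ≡ jlin L' n [ZMOD (k : ℤ)]) := by
  rcases h with (h | h | h | h | h) | h
  · exact ⟨(rotate_inv L L' h).1, fun hb n _ => by rw [(rotate_inv L L' h).2 hb n]⟩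
  · exact ⟨(relabel_inv L L' h).1, fun hb n _ => by rw [(relabel_inv L L' h).2 n]⟩
  · exact ⟨(reid1_inv L L' h).1, fun hb n hn => by rw [(reid1_inv L L' h).2 n hn]⟩
  · exact ⟨(reid2_inv L L' h).1, fun hb n _ => by rw [(reid2_inv L L' h).2 n]⟩
  · exact ⟨(reid3_inv L L' h).1, fun hb n _ => by rw [(reid3_inv L L' h).2 n]⟩
  · exact ⟨(move2k_inv k L L' h).1, fun hb n _ => (move2k_inv k L L' h).2 n⟩

lemma rel_inv (k : ℕ) (L L' : List Endpoint) (h : Rel2k k L L') (hb : Bal L) :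
    Bal L' ∧ ∀ n, n ≠ 0 → jlin L n ≡ jlin L' n [ZMOD (k : ℤ)] := by
  unfold Rel2k Moves at h
  induction h with
  | refl => exact ⟨hb, fun _ _ => rfl⟩
  | tail _ h ih =>
    rcases h with h | h
    · have := step_inv k _ _ h
      exact ⟨this.1.1 ih.1, fun n hn => (ih.2 n hn).trans (this.2 ih.1 n hn)⟩
    · have := step_inv k _ _ h
      have hb' := this.1.2 ih.1
      exact ⟨hb', fun n hn => (ih.2 n hn).trans (this.2 hb' n hn).symm⟩

lemma wsum_fiber (L : List Endpoint) (T : Finset ℕ) (hT : ∀ e ∈ L, e.label ∈ T) :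
    wsum L = ∑ c ∈ T, wsum (L.filter (fun x => x.label == c)) := by
  induction L with
  | nil => simp
  | cons e L ih =>
    simp only [List.mem_cons, forall_eq_or_imp] at hT
    have : ∀ c, wsum ((e :: L).filter (fun x => x.label == c)) =
        (if e.label = c then endpointValue e else 0) +
          wsum (L.filter (fun x => x.label == c)) := by
      intro c
      by_cases h : e.label = c <;> simp [List.filter_cons, h]
    simp only [this, Finset.sum_add_distrib, ← ih hT.2, wsum_cons]
    simp [hT.1]

lemma ncount_filter (L : List Endpoint) (c : ℕ) :
    ncount c L = ncount c (L.filter (fun x => x.label == c)) := by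
  induction L with
  | nil => rfl
  | cons e L ih =>
    by_cases h : e.label = c <;> simp [List.filter_cons, h, ncount, ih]

lemma gauss_filter (L : List Endpoint) (hG : IsGaussDiagram L) (c : ℕ) :
    L.filter (fun x => x.label == c) = [] ∨
    ∃ t s, L.filter (fun x => x.label == c) = [⟨c, t, s⟩, ⟨c, !t, s⟩] := by
  by_cases h : ∃ e ∈ L, e.label = c
  · right
    obtain ⟨e, he, rfl⟩ := h
    obtain ⟨h1, e', he', hl, ht, hs⟩ := hG e he
    obtain ⟨x, y, hxy⟩ := List.length_eq_two.1 h1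
    have m1 : e ∈ L.filter (fun x => x.label == e.label) := by simp [he]
    have m2 : e' ∈ L.filter (fun x => x.label == e.label) := by simp [he', hl]
    rw [hxy] at m1 m2 ⊢
    obtain ⟨l, t, s⟩ := e
    obtain ⟨l', t', s'⟩ := e'
    simp only at hl ht hs
    subst hl ht hs
    simp only [List.mem_cons, List.not_mem_nil, or_false] at m1 m2
    rcases m1 with rfl | rfl <;> rcases m2 with h | h
    · simp at h
    · exact ⟨t, s', by rw [← h]⟩
    · exact ⟨!t, s', by rw [← h]; simp⟩
    · simp at h
  · left
    rw [List.filter_eq_nil_iff]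
    intro e he
    simp only [beq_iff_eq]
    exact fun h' => h ⟨e, he, h'⟩

lemma gauss_bal (L : List Endpoint) (hG : IsGaussDiagram L) : Bal L := by
  constructor
  · rw [wsum_fiber L (labels L).toFinset (by
      intro e he; simp only [labels, List.mem_toFinset, List.mem_map]; exact ⟨e, he, rfl⟩)]
    refine Finset.sum_eq_zero fun c _ => ?_
    rcases gauss_filter L hG c with h | ⟨t, s, h⟩ <;> rw [h]
    · rfl
    · cases t <;> simp [endpointValue, signValue]
  · intro c
    rw [ncount_filter]
    rcases gauss_filter L hG c with h | ⟨t, s, h⟩ <;> rw [h]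
    · rfl
    · cases t <;> simp [ncount]

lemma rotateTo_split (L : List Endpoint) (p : Endpoint → Bool) (h : ∃ e ∈ L, p e = true) :
    ∃ A x R, p x = true ∧ L = A ++ x :: R ∧ rotateTo L p = x :: (R ++ A) := by
  have h1 : (L.findIdx? p).isSome := by
    rw [List.findIdx?_isSome, List.any_eq_true]; exact h
  obtain ⟨i, hi⟩ := Option.isSome_iff_exists.1 h1
  obtain ⟨hlt, hp, -⟩ := List.findIdx?_eq_some_iff_getElem.1 hi
  refine ⟨L.take i, L[i], L.drop (i + 1), hp, ?_, ?_⟩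
  · rw [← List.drop_eq_getElem_cons hlt, List.take_append_drop]
  · unfold rotateTo
    rw [hi]
    simp only
    rw [List.drop_eq_getElem_cons hlt]; rfl

lemma wt_takeWhile (c : ℕ) (acc : ℤ) (M : List Endpoint) (s : Bool)
    (h : M.filter (fun x => x.label == c) = [⟨c, true, s⟩]) :
    wt c acc M = acc + wsum (M.takeWhile (fun e => e.label != c)) := by
  induction M generalizing acc with
  | nil => simp at h
  | cons e M ih =>
    by_cases hc : e.label = c
    · simp only [List.filter_cons, hc, beq_self_eq_true, if_true, List.cons.injEq] at h
      obtain ⟨rfl, h⟩ := h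
      have : c ∉ labels M := by
        intro hm
        simp only [labels, List.mem_map] at hm
        obtain ⟨y, hy, hyc⟩ := hm
        have := List.filter_eq_nil_iff.1 h y hy
        simp [hyc] at this
      simp [wt, wt_fresh _ _ _ this]
    · have h' : M.filter (fun x => x.label == c) = [⟨c, true, s⟩] := by
        simpa [List.filter_cons, hc] using h
      simp [wt, ih _ h', hc, List.takeWhile_cons]
      ring

lemma chordIndex_eq (L : List Endpoint) (hG : IsGaussDiagram L) (e : Endpoint) (he : e ∈ L) :
    chordIndex L e.label = wt e.label 0 L := by
  have hb := gauss_bal L hG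
  have hne : ∃ x ∈ L, (x.label == e.label && !x.isTerminal) = true := by
    obtain ⟨-, e', he', hl, ht, -⟩ := hG e he
    cases hte : e.isTerminal
    · exact ⟨e, he, by simp [hte]⟩
    · exact ⟨e', he', by simp [hl, ht, hte]⟩
  obtain ⟨A, x, R, hx, hL, hrot⟩ := rotateTo_split L _ hne
  have hf := gauss_filter L hG e.label
  generalize e.label = c at *
  simp only [Bool.and_eq_true, beq_iff_eq, Bool.not_eq_true'] at hx
  obtain ⟨hxl, hxt⟩ := hx
  unfold chordIndex
  rw [hrot]
  have hperm : (L.filter (fun x => x.label == c)).Perm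
      ((x :: (R ++ A)).filter (fun x => x.label == c)) := by
    apply List.Perm.filter
    rw [hL]
    exact List.perm_append_comm
  have hfx : (x :: (R ++ A)).filter (fun x => x.label == c) =
      x :: (R ++ A).filter (fun x => x.label == c) := by simp [List.filter_cons, hxl]
  rw [hfx] at hperm
  have hM : ∃ s, (R ++ A).filter (fun x => x.label == c) = [⟨c, true, s⟩] := by
    rcases hf with h | ⟨t, s, h⟩
    · rw [h] at hperm; simpa using hperm.symm.eq_nil
    · rw [h] at hperm
      have hm : x ∈ [(⟨c, t, s⟩ : Endpoint), ⟨c, !t, s⟩] := hperm.symm.subset (by simp)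
      refine ⟨s, ?_⟩
      simp only [List.mem_cons, List.not_mem_nil, or_false] at hm
      rcases hm with rfl | rfl
      · simp only at hxt; subst hxt
        have := (List.perm_cons _).1 hperm
        simpa using this.symm
      · have ht : t = true := by simpa using hxt
        subst ht
        have := (List.perm_cons _).1 ((List.Perm.swap _ _ _).trans hperm)
        simpa using this.symm
  obtain ⟨s, hM⟩ := hM
  have hw : wt c 0 L = wt c 0 (x :: (R ++ A)) := by
    rw [hL] at hb ⊢
    exact (wt_rotate c A (x :: R) hb).symm
  rw [hw]
  simp only [wt, hxl, hxt, wt_takeWhile c _ _ s hM, List.drop_one, List.tail_cons]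
  simp [wsum]

lemma jn_eq (L : List Endpoint) (hG : IsGaussDiagram L) (n : ℤ) : Jn L n = jlin L n := by
  unfold Jn jlin
  have key : ∀ M : List Endpoint, (∀ e ∈ M, chordIndex L e.label = wt e.label 0 L) →
      ((M.filter (fun e => e.isTerminal && decide (chordIndex L e.label = n))).map signValue).sum
        = jsum (fun c => wt c 0 L) n M := by
    intro M hM
    induction M with
    | nil => rfl
    | cons e M ih =>
      simp only [List.mem_cons, forall_eq_or_imp] at hM
      simp only [jsum, ← ih hM.2, List.filter_cons, hM.1]
      by_cases h1 : e.isTerminal = true <;> by_cases h2 : wt e.label 0 L = n <;> simp [h1, h2]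
  exact key L (fun e he => chordIndex_eq L hG e he)

end Gauss

open Gauss in
/-- if two virtual knots are related by a finite sequence of
2k-moves (k ≥ 1), then their n-writhes are congruent mod k for all n ≠ 0. -/
theorem jn_modEq_of_rel2k (k : ℕ) (hk : 0 < k)
    (G G' : List Endpoint) (hG : IsGaussDiagram G) (hG' : IsGaussDiagram G')
    (h : Rel2k k G G') (n : ℤ) (hn : n ≠ 0) :
    Jn G n ≡ Jn G' n [ZMOD (k : ℤ)] := by
  rw [jn_eq G hG, jn_eq G' hG']
  exact (rel_inv k G G' h (gauss_bal G hG)).2 n hn
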